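/- Let u : P₂(ℝⁿ) → ℝ admit a first-order functional derivative ∂u/∂m, and assume that the map (m,x) ↦ D²ₓ(∂u/∂m)(m)(x) is jointly continuous and bounded. Then for any m, m' ∈ P₂(ℝⁿ), any t ∈ [0,1], and any random variables X_m, X_{m'} on a probability space with laws m, m' respectively, one has d/dt u(m+t(m'−m)) = E[ Dₓ(∂u/∂m)(m+t(m'−m))(X_m) · (X_{m'}−X_m) ] + E[ ∫₀¹∫₀¹ α D²ₓ(∂u/∂m)(m+t(m'−m))(X_m+αβ(X_{m'}−X_m))(X_{m'}−X_m) · (X_{m'}−X_m) dα dβ ]. -/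

import Mathlib

open MeasureTheory ProbabilityTheory
open scoped RealInnerProductSpace

noncomputable section

abbrev En (n : ℕ) : Type := EuclideanSpace ℝ (Fin n)

/-- `μ ∈ P₂(ℝⁿ)`: a Borel probability measure with finite second moment. -/
def IsP2 {n : ℕ} (μ : Measure (En n)) : Prop :=
  IsProbabilityMeasure μ ∧ Integrable (fun x => ‖x‖ ^ 2) μ

/-- The convex combination `m + t(m' − m) = (1−t)·m + t·m'`. -/
def mix {n : ℕ} (m m' : Measure (En n)) (t : ℝ) : Measure (En n) :=
  ENNReal.ofReal (1 - t) • m + ENNReal.ofReal t • m'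

/-- The squared Wasserstein-2 distance, as infimum of transport costs over couplings. -/
def W2sq {n : ℕ} (μ ν : Measure (En n)) : ENNReal :=
  ⨅ (γ : Measure (En n × En n)) (_ : γ.map Prod.fst = μ ∧ γ.map Prod.snd = ν),
    ∫⁻ p, ENNReal.ofReal (‖p.1 - p.2‖ ^ 2) ∂γ

/-- Joint continuity of `(m,x) ↦ g m x` on `P₂(ℝⁿ) × ℝⁿ`
(w.r.t. the Wasserstein and Euclidean distances). -/
def JointCont {n : ℕ} {E : Type*} [PseudoMetricSpace E]
    (g : Measure (En n) → En n → E) : Prop :=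
  ∀ m : Measure (En n), IsP2 m → ∀ x : En n, ∀ ε > (0:ℝ), ∃ δ > (0:ℝ),
    ∀ m' : Measure (En n), IsP2 m' → ∀ x' : En n,
      W2sq m m' < ENNReal.ofReal δ → dist x x' < δ → dist (g m' x') (g m x) < ε

/-- Joint continuity of `(m,ξ,η) ↦ g m ξ η` on `P₂(ℝⁿ) × ℝⁿ × ℝⁿ`. -/
def JointCont2 {n : ℕ} {E : Type*} [PseudoMetricSpace E]
    (g : Measure (En n) → En n → En n → E) : Prop :=
  ∀ m : Measure (En n), IsP2 m → ∀ ξ η : En n, ∀ ε > (0:ℝ), ∃ δ > (0:ℝ),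
    ∀ m' : Measure (En n), IsP2 m' → ∀ ξ' η' : En n,
      W2sq m m' < ENNReal.ofReal δ → dist ξ ξ' < δ → dist η η' < δ →
        dist (g m' ξ' η') (g m ξ η) < ε

/-- `c` is continuous on `P₂(ℝⁿ)` and bounded on bounded subsets of `P₂(ℝⁿ)`. -/
def ContBddOnBdd {n : ℕ} (c : Measure (En n) → ℝ) : Prop :=
  (∀ m : Measure (En n), IsP2 m → ∀ ε > (0:ℝ), ∃ δ > (0:ℝ),
      ∀ m' : Measure (En n), IsP2 m' → W2sq m m' < ENNReal.ofReal δ → |c m' - c m| < ε) ∧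
  (∀ R : ℝ, ∃ M : ℝ, ∀ m : Measure (En n), IsP2 m →
      W2sq m (Measure.dirac 0) ≤ ENNReal.ofReal R → |c m| ≤ M)

/-- `u` admits the first-order functional derivative `δu` on `P₂(ℝⁿ)`. -/
structure FunctDeriv {n : ℕ} (u : Measure (En n) → ℝ)
    (δu : Measure (En n) → En n → ℝ) : Prop where
  cont : JointCont δu
  growth : ∃ c : Measure (En n) → ℝ, ContBddOnBdd c ∧
    ∀ m, IsP2 m → ∀ x, |δu m x| ≤ c m * (1 + ‖x‖ ^ 2)
  deriv : ∀ m m' : Measure (En n), IsP2 m → IsP2 m' → ∀ t ∈ Set.Icc (0:ℝ) 1,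
    HasDerivWithinAt (fun s => u (mix m m' s))
      ((∫ x, δu (mix m m' t) x ∂m') - ∫ x, δu (mix m m' t) x ∂m) (Set.Icc 0 1) t

/-- `u` admits the second-order functional derivative `δ2u` on `P₂(ℝⁿ)`
(`δu` being its first-order functional derivative). -/
structure FunctDeriv2 {n : ℕ} (u : Measure (En n) → ℝ)
    (δu : Measure (En n) → En n → ℝ)
    (δ2u : Measure (En n) → En n → En n → ℝ) : Prop where
  cont : JointCont2 δ2u
  symm : ∀ m ξ η, δ2u m ξ η = δ2u m η ξ
  growth : ∃ c : Measure (En n) → ℝ, ContBddOnBdd c ∧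
    ∀ m, IsP2 m → ∀ ξ η, |δ2u m ξ η| ≤ c m * (1 + ‖ξ‖ ^ 2 + ‖η‖ ^ 2)
  deriv2 : ∀ m m' : Measure (En n), IsP2 m → IsP2 m' → ∀ t ∈ Set.Icc (0:ℝ) 1,
    HasDerivWithinAt
      (fun s => (∫ x, δu (mix m m' s) x ∂m') - ∫ x, δu (mix m m' s) x ∂m)
      (((∫ ξ, (∫ η, δ2u (mix m m' t) ξ η ∂m') ∂m')
          - ∫ ξ, (∫ η, δ2u (mix m m' t) ξ η ∂m) ∂m')
        - ((∫ ξ, (∫ η, δ2u (mix m m' t) ξ η ∂m') ∂m)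
          - ∫ ξ, (∫ η, δ2u (mix m m' t) ξ η ∂m) ∂m))
      (Set.Icc 0 1) t

end

lemma isP2_mix {n : ℕ} {m m' : Measure (En n)} (hm : IsP2 m) (hm' : IsP2 m')
    {t : ℝ} (ht : t ∈ Set.Icc (0:ℝ) 1) : IsP2 (mix m m' t) := by
  obtain ⟨hp, hi⟩ := hm
  obtain ⟨hp', hi'⟩ := hm'
  refine ⟨⟨?_⟩, ?_⟩
  · simp only [mix, Measure.coe_add, Measure.coe_smul, Pi.add_apply, Pi.smul_apply, measure_univ,
      smul_eq_mul, mul_one]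
    rw [← ENNReal.ofReal_add (by linarith [ht.2]) ht.1]
    simp
  · exact (hi.smul_measure ENNReal.ofReal_ne_top).add_measure
      (hi'.smul_measure ENNReal.ofReal_ne_top)

lemma W2sq_self {n : ℕ} (μ : Measure (En n)) : W2sq μ μ = 0 := by
  have hd : Measurable fun x : En n => (x, x) := by fun_prop
  refine le_antisymm (iInf₂_le_of_le (μ.map fun x => (x, x)) ⟨?_, ?_⟩ ?_) bot_le
  · rw [Measure.map_map measurable_fst hd]
    exact Measure.map_id
  · rw [Measure.map_map measurable_snd hd]
    exact Measure.map_id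
  · rw [lintegral_map (by fun_prop) hd]
    simp

lemma JointCont.continuous {n : ℕ} {E : Type*} [PseudoMetricSpace E]
    {g : Measure (En n) → En n → E} (hg : JointCont g) {m : Measure (En n)} (hm : IsP2 m) :
    Continuous (g m) := by
  refine Metric.continuous_iff.2 fun x ε hε => ?_
  obtain ⟨δ, hδ, h⟩ := hg m hm x ε hε
  refine ⟨δ, hδ, fun y hy => h m hm y ?_ (by rwa [dist_comm])⟩
  rw [W2sq_self]
  exact ENNReal.ofReal_pos.2 hδ

/-- Second-order Taylor expansion with iterated integral remainder. -/
lemma integral_taylor_remainder {E : Type*} [NormedAddCommGroup E] [InnerProductSpace ℝ E]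
    [CompleteSpace E] {f : E → ℝ} {g : E → E} {H : E → E →L[ℝ] E}
    (hf : ∀ x, HasGradientAt f (g x) x) (hg : ∀ x, HasFDerivAt g (H x) x)
    (hH : Continuous H) (x v : E) :
    (∫ α in (0:ℝ)..1, ∫ β in (0:ℝ)..1, α * ⟪H (x + (α * β) • v) v, v⟫)
      = f (x + v) - f x - ⟪g x, v⟫ := by
  have hgc : Continuous g := continuous_iff_continuousAt.2 fun y => (hg y).continuousAt
  have inner_eq : ∀ α : ℝ, (∫ β in (0:ℝ)..1, α * ⟪H (x + (α * β) • v) v, v⟫)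
      = ⟪g (x + α • v), v⟫ - ⟪g x, v⟫ := by
    intro α
    have hd : ∀ β ∈ Set.uIcc (0:ℝ) 1, HasDerivAt (fun β : ℝ => ⟪g (x + (α * β) • v), v⟫)
        (α * ⟪H (x + (α * β) • v) v, v⟫) β := by
      intro β _
      have h1 : HasDerivAt (fun β : ℝ => x + (α * β) • v) (α • v) β := by
        simpa using (((hasDerivAt_id β).const_mul α).smul_const v).const_add x
      have h2 := (hg (x + (α * β) • v)).comp_hasDerivAt β h1
      simpa [real_inner_smul_left] using h2.inner ℝ (hasDerivAt_const β v)
    rw [intervalIntegral.integral_eq_sub_of_hasDerivAt hd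
      (Continuous.intervalIntegrable (by fun_prop) _ _)]
    simp
  simp_rw [inner_eq]
  have hd : ∀ α ∈ Set.uIcc (0:ℝ) 1, HasDerivAt (fun α : ℝ => f (x + α • v) - α * ⟪g x, v⟫)
      (⟪g (x + α • v), v⟫ - ⟪g x, v⟫) α := by
    intro α _
    have h1 : HasDerivAt (fun α : ℝ => x + α • v) v α := by
      simpa using ((hasDerivAt_id α).smul_const v).const_add x
    have h2 := (hf (x + α • v)).hasFDerivAt.comp_hasDerivAt α h1
    have h3 := (hasDerivAt_id α).mul_const ⟪g x, v⟫
    exact (h2.sub h3).congr_deriv (by simp)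
  rw [intervalIntegral.integral_eq_sub_of_hasDerivAt hd
    (Continuous.intervalIntegrable (by fun_prop) _ _)]
  simp
  ring

noncomputable section

/-- Lemma 2.1: first-order expansion of d/dt u(m+t(m'−m)) in terms of random variables
with laws m, m'. -/
theorem stmt0 {n : ℕ} (u : Measure (En n) → ℝ)
    (δu : Measure (En n) → En n → ℝ)
    (Dδu : Measure (En n) → En n → En n)
    (D2δu : Measure (En n) → En n → (En n →L[ℝ] En n))
    (hFD : FunctDeriv u δu)
    (hgrad : ∀ m x, HasGradientAt (δu m) (Dδu m x) x)
    (hhess : ∀ m x, HasFDerivAt (Dδu m) (D2δu m x) x)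
    (hcont : JointCont D2δu)
    (hbdd : ∃ M : ℝ, ∀ m x, IsP2 m → ‖D2δu m x‖ ≤ M)
    (m m' : Measure (En n)) (hm : IsP2 m) (hm' : IsP2 m')
    (t : ℝ) (ht : t ∈ Set.Icc (0:ℝ) 1)
    (Ω : Type) [MeasurableSpace Ω] (P : Measure Ω) (hP : IsProbabilityMeasure P)
    (Xm Xm' : Ω → En n) (hXm : Measurable Xm) (hXm' : Measurable Xm')
    (hlaw : P.map Xm = m) (hlaw' : P.map Xm' = m') :
    HasDerivWithinAt (fun s => u (mix m m' s))
      ((∫ ω, ⟪Dδu (mix m m' t) (Xm ω), Xm' ω - Xm ω⟫ ∂P)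
        + ∫ ω, (∫ α in (0:ℝ)..1, ∫ β in (0:ℝ)..1,
            α * ⟪D2δu (mix m m' t) (Xm ω + (α * β) • (Xm' ω - Xm ω)) (Xm' ω - Xm ω),
              Xm' ω - Xm ω⟫) ∂P)
      (Set.Icc 0 1) t := by
  have hμ := isP2_mix hm hm' ht
  have hder := hFD.deriv m m' hm hm' t ht
  obtain ⟨c, -, hc⟩ := hFD.growth
  obtain ⟨M, hM⟩ := hbdd
  set μ := mix m m' t
  have hfc : Continuous (δu μ) :=
    continuous_iff_continuousAt.2 fun y => (hgrad μ y).hasFDerivAt.continuousAt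
  have hgc : Continuous (Dδu μ) :=
    continuous_iff_continuousAt.2 fun y => (hhess μ y).continuousAt
  have hfint : ∀ {ν : Measure (En n)}, IsP2 ν → Integrable (δu μ) ν := by
    rintro ν ⟨hν, hν2⟩
    exact (((integrable_const (1:ℝ)).add hν2).const_mul (c μ)).mono'
      hfc.aestronglyMeasurable (.of_forall fun x => hc μ hμ x)
  have hsq : ∀ {X : Ω → En n}, Measurable X → IsP2 (P.map X) →
      Integrable (fun ω => ‖X ω‖ ^ 2) P := fun hX h => h.2.comp_measurable hX
  have hlip : ∀ x, ‖Dδu μ x‖ ≤ ‖Dδu μ 0‖ + M * ‖x‖ := by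
    intro x
    have h := convex_univ.norm_image_sub_le_of_norm_hasFDerivWithin_le
      (fun y _ => (hhess μ y).hasFDerivWithinAt) (fun y _ => hM μ y hμ)
      (Set.mem_univ (0 : En n)) (Set.mem_univ x)
    have := norm_le_norm_add_norm_sub' (Dδu μ x) (Dδu μ 0)
    rw [sub_zero] at h
    linarith
  have hM0 : 0 ≤ M := (norm_nonneg _).trans (hM μ 0 hμ)
  have hint1 : Integrable (fun ω => ⟪Dδu μ (Xm ω), Xm' ω - Xm ω⟫) P := by
    refine ((((integrable_const (1:ℝ)).add (hsq hXm (hlaw ▸ hm))).add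
      (hsq hXm' (hlaw' ▸ hm'))).const_mul (2 * (‖Dδu μ 0‖ + M))).mono' ?_
      (.of_forall fun ω => ?_)
    · exact ((hgc.measurable.comp hXm).inner (hXm'.sub hXm)).aestronglyMeasurable
    · have h1 : ‖Xm' ω - Xm ω‖ ≤ ‖Xm' ω‖ + ‖Xm ω‖ := norm_sub_le _ _
      refine (norm_inner_le_norm _ _).trans
        ((mul_le_mul (hlip (Xm ω)) h1 (norm_nonneg _) (by positivity)).trans ?_)
      simp only [Pi.add_apply]
      generalize ‖Xm ω‖ = a
      generalize ‖Xm' ω‖ = b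
      have hG : 0 ≤ ‖Dδu μ 0‖ := norm_nonneg _
      generalize ‖Dδu μ 0‖ = G at *
      have e1 : G * (a + b) ≤ G * (2 * (1 + a ^ 2 + b ^ 2)) :=
        mul_le_mul_of_nonneg_left (by nlinarith [sq_nonneg (a - 1), sq_nonneg (b - 1)]) hG
      have e2 : M * (a * (a + b)) ≤ M * (2 * (1 + a ^ 2 + b ^ 2)) :=
        mul_le_mul_of_nonneg_left (by nlinarith [sq_nonneg (a - b)]) hM0
      linarith
  have hf1 : Integrable (fun ω => δu μ (Xm ω)) P :=
    (hlaw ▸ hfint hm : Integrable (δu μ) (P.map Xm)).comp_measurable hXm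
  have hf2 : Integrable (fun ω => δu μ (Xm' ω)) P :=
    (hlaw' ▸ hfint hm' : Integrable (δu μ) (P.map Xm')).comp_measurable hXm'
  have hT := fun ω => integral_taylor_remainder (hgrad μ) (hhess μ) (hcont.continuous hμ)
    (Xm ω) (Xm' ω - Xm ω)
  simp only [add_sub_cancel] at hT
  simp_rw [hT]
  rw [integral_sub (by exact hf2.sub hf1) hint1, integral_sub hf2 hf1, add_sub_cancel]
  have i1 : ∫ x, δu μ x ∂m = ∫ ω, δu μ (Xm ω) ∂P := by
    rw [← hlaw, integral_map hXm.aemeasurable hfc.aestronglyMeasurable]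
  have i2 : ∫ x, δu μ x ∂m' = ∫ ω, δu μ (Xm' ω) ∂P := by
    rw [← hlaw', integral_map hXm'.aemeasurable hfc.aestronglyMeasurable]
  rwa [i1, i2] at hder

end
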